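/- arXiv:math/0506170 — 2 statements merged into one kernel-verified Lean document; each statement's English description precedes it below -/
import Mathlib

section
/- Let χ ∈ Σ_n be a primitive permutation with n ≥ 2. Then for every m ≥ 1, the number of permutations σ ∈ Σ_m with κ(σ) = χ equals the binomial coefficient C(m+1, n+1). -/
namespace MarklOps

/-- `a(σ)`: the largest `a` such that `σ` fixes the first `a` points (0-based: all `j < a`). -/
def aOf {m : ℕ} (σ : Equiv.Perm (Fin m)) : ℕ :=
  Nat.findGreatest (fun a => ∀ j : Fin m, (j : ℕ) < a → σ j = j) m

/-- `c(σ)`: the largest `c` such that `σ` fixes the last `c` points. -/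
def cOf {m : ℕ} (σ : Equiv.Perm (Fin m)) : ℕ :=
  Nat.findGreatest (fun c => ∀ j : Fin m, m - c ≤ (j : ℕ) → σ j = j) m

/-- Length `m − a(σ) − c(σ)` of the middle block of `σ`. -/
def midLen {m : ℕ} (σ : Equiv.Perm (Fin m)) : ℕ := m - aOf σ - cOf σ

lemma fix_low {m : ℕ} (σ : Equiv.Perm (Fin m)) (j : Fin m) (hj : (j : ℕ) < aOf σ) :
    σ j = j := by
  have h := Nat.findGreatest_spec (P := fun a => ∀ j : Fin m, (j : ℕ) < a → σ j = j)
    (Nat.zero_le m) (fun j hj => absurd hj (by omega))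
  exact h j hj

lemma fix_high {m : ℕ} (σ : Equiv.Perm (Fin m)) (j : Fin m) (hj : m - cOf σ ≤ (j : ℕ)) :
    σ j = j := by
  have h := Nat.findGreatest_spec (P := fun c => ∀ j : Fin m, m - c ≤ (j : ℕ) → σ j = j)
    (Nat.zero_le m) (fun j hj => absurd hj (by have := j.isLt; omega))
  exact h j hj

lemma mid_mem {m : ℕ} (σ : Equiv.Perm (Fin m)) (x : Fin m)
    (hx : aOf σ ≤ (x : ℕ) ∧ (x : ℕ) < m - cOf σ) :
    aOf σ ≤ (σ x : ℕ) ∧ (σ x : ℕ) < m - cOf σ := by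
  by_contra hcon
  have h1 : (σ x : ℕ) < aOf σ ∨ m - cOf σ ≤ (σ x : ℕ) := by omega
  have h2 : σ (σ x) = σ x := h1.elim (fix_low σ _) (fix_high σ _)
  have h3 : σ x = x := σ.injective h2
  rw [h3] at h1
  omega

/-- The middle part `ω(σ)` of `σ` as a function, `s ↦ σ(a(σ)+s) − a(σ)`. -/
def midFun {m : ℕ} (σ : Equiv.Perm (Fin m)) (s : Fin (midLen σ)) : Fin (midLen σ) :=
  ⟨(σ ⟨aOf σ + (s : ℕ), by have := s.isLt; unfold midLen at this; omega⟩ : ℕ) - aOf σ, by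
    have hs := s.isLt
    unfold midLen at hs ⊢
    have hm := mid_mem σ ⟨aOf σ + (s : ℕ), by omega⟩
      ⟨by simp, by simp; omega⟩
    omega⟩

lemma midFun_injective {m : ℕ} (σ : Equiv.Perm (Fin m)) : Function.Injective (midFun σ) := by
  intro s t h
  have hs := s.isLt
  have ht := t.isLt
  unfold midLen at hs ht
  have hv : ((σ ⟨aOf σ + (s : ℕ), by omega⟩ : Fin m) : ℕ) - aOf σ
      = ((σ ⟨aOf σ + (t : ℕ), by omega⟩ : Fin m) : ℕ) - aOf σ := congrArg Fin.val h
  have hms := mid_mem σ ⟨aOf σ + (s : ℕ), by omega⟩ ⟨by simp, by simp; omega⟩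
  have hmt := mid_mem σ ⟨aOf σ + (t : ℕ), by omega⟩ ⟨by simp, by simp; omega⟩
  have hv2 : (σ ⟨aOf σ + (s : ℕ), by omega⟩ : Fin m) = σ ⟨aOf σ + (t : ℕ), by omega⟩ :=
    Fin.ext (by omega)
  have := congrArg Fin.val (σ.injective hv2)
  simp at this
  exact Fin.ext (by omega)

/-- The middle part `ω(σ) ∈ Σ_{m−a(σ)−c(σ)}` of `σ`, with `ω(σ)(s) = σ(a(σ)+s) − a(σ)`. -/
noncomputable def midPerm {m : ℕ} (σ : Equiv.Perm (Fin m)) : Equiv.Perm (Fin (midLen σ)) :=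
  Equiv.ofBijective (midFun σ) (Finite.injective_iff_bijective.mp (midFun_injective σ))

/-- `b(σ)`: the number of doubled strings in `ω(σ)`, i.e. of indices `s` with
`ω(σ)(s+1) = ω(σ)(s)+1`. -/
noncomputable def bOf {m : ℕ} (σ : Equiv.Perm (Fin m)) : ℕ :=
  (Finset.univ.filter fun s : Fin (midLen σ) =>
    ∃ h : (s : ℕ) + 1 < midLen σ,
      (midPerm σ ⟨(s : ℕ) + 1, h⟩ : ℕ) = (midPerm σ s : ℕ) + 1).card

/-- The grade `g(σ)` of a permutation `σ ∈ Σ_m`: `g(id_m) = m−1` and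
`g(σ) = a(σ) + b(σ) + c(σ)` otherwise.  A permutation is primitive iff its grade is `0`. -/
noncomputable def grade {m : ℕ} (σ : Equiv.Perm (Fin m)) : ℕ :=
  if σ = 1 then m - 1 else aOf σ + bOf σ + cOf σ

/-- The set of least elements (class starts) of the equivalence classes of the relation
generated by `s ∼ s+1` whenever `ω(σ)(s+1) = ω(σ)(s)+1` on the middle block of `σ`. -/
noncomputable def startSet {m : ℕ} (σ : Equiv.Perm (Fin m)) : Finset (Fin (midLen σ)) :=
  Finset.univ.filter fun s : Fin (midLen σ) =>
    (s : ℕ) = 0 ∨ ∀ _h : 0 < (s : ℕ),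
      (midPerm σ s : ℕ) ≠ (midPerm σ ⟨(s : ℕ) - 1, by have := s.isLt; omega⟩ : ℕ) + 1

/-- The skeleton `κ(σ) ∈ Σ_{m−g(σ)}`, bundled with its arity: `skel σ = ⟨m − g(σ), κ(σ)⟩`.
It sends `t` to the rank, among the images of all classes ordered by their least elements,
of the image under `ω(σ)` of the `t`-th class (classes ordered by their least elements);
since each class is an interval mapped by `ω(σ)` onto an interval, this is the rank of
`ω(σ)(s_t)` among the values of `ω(σ)` at all class starts, where `s_t` is the `t`-th class
start.  By convention `κ(id_m) = id_1`. -/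
noncomputable def skel {m : ℕ} (σ : Equiv.Perm (Fin m)) : Σ n : ℕ, Equiv.Perm (Fin n) :=
  if σ = 1 then ⟨1, 1⟩
  else
    ⟨(startSet σ).card,
      ((startSet σ).orderIsoOfFin rfl).toEquiv.trans
        ((Equiv.ofBijective
            (fun x : {y // y ∈ startSet σ} =>
              (⟨midPerm σ x.1, Finset.mem_image_of_mem _ x.2⟩ :
                {y // y ∈ (startSet σ).image (fun s => midPerm σ s)}))
            ⟨fun x y hxy => Subtype.ext ((midPerm σ).injective (congrArg Subtype.val hxy)),
             fun y => by
               obtain ⟨x, hx, hxy⟩ := Finset.mem_image.mp y.2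
               exact ⟨⟨x, hx⟩, Subtype.ext hxy⟩⟩).trans
          (((startSet σ).image (fun s => midPerm σ s)).orderIsoOfFin
            (Finset.card_image_of_injective _ (midPerm σ).injective)).toEquiv.symm)⟩

open Finset

/-- The extension of `σ ∈ Σ_m` to `ℕ`, shifted by one: it fixes `0` and all `j > m`, and acts
as `σ` on `{1, …, m}`. -/
def extendNat {m : ℕ} (σ : Equiv.Perm (Fin m)) : ℕ → ℕ
  | 0 => 0
  | j + 1 => if h : j < m then (σ ⟨j, h⟩ : ℕ) + 1 else j + 1

section extendNat

variable {m : ℕ} (σ : Equiv.Perm (Fin m))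

@[simp] lemma extendNat_zero : extendNat σ 0 = 0 := rfl

lemma extendNat_succ (i : Fin m) : extendNat σ ((i : ℕ) + 1) = (σ i : ℕ) + 1 := by
  simp [extendNat]

lemma extendNat_of_lt {i : ℕ} (hi : m < i) : extendNat σ i = i := by
  obtain ⟨j, rfl⟩ : ∃ j, i = j + 1 := ⟨i - 1, by omega⟩
  simp only [extendNat]
  rw [dif_neg (by omega)]

lemma eq_zero_or_fin_or_lt (m i : ℕ) : i = 0 ∨ (∃ j : Fin m, i = (j : ℕ) + 1) ∨ m < i := by
  rcases Nat.eq_zero_or_pos i with h | h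
  · exact Or.inl h
  · by_cases h' : m < i
    · exact Or.inr (Or.inr h')
    · exact Or.inr (Or.inl ⟨⟨i - 1, by omega⟩, by simp; omega⟩)

lemma extendNat_le {i : ℕ} (hi : i ≤ m) : extendNat σ i ≤ m := by
  rcases eq_zero_or_fin_or_lt m i with rfl | ⟨j, rfl⟩ | h
  · simp
  · rw [extendNat_succ]; exact (σ j).isLt
  · omega

lemma extendNat_surjective : Function.Surjective (extendNat σ) := by
  intro i
  rcases eq_zero_or_fin_or_lt m i with rfl | ⟨j, rfl⟩ | h
  · exact ⟨0, rfl⟩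
  · exact ⟨(σ.symm j : ℕ) + 1, by rw [extendNat_succ]; simp⟩
  · exact ⟨i, extendNat_of_lt σ h⟩

lemma extendNat_injective : Function.Injective (extendNat σ) := by
  intro i j hij
  rcases eq_zero_or_fin_or_lt m i with rfl | ⟨i', rfl⟩ | hi <;>
  rcases eq_zero_or_fin_or_lt m j with rfl | ⟨j', rfl⟩ | hj <;>
  try simp only [extendNat_zero, extendNat_succ] at hij
  · rfl
  · omega
  · rw [extendNat_of_lt σ hj] at hij; omega
  · omega
  · rw [σ.injective (Fin.ext (by omega : (σ i' : ℕ) = σ j'))]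
  · rw [extendNat_of_lt σ hj] at hij; omega
  · rw [extendNat_of_lt σ hi] at hij; omega
  · rw [extendNat_of_lt σ hi] at hij; omega
  · rwa [extendNat_of_lt σ hi, extendNat_of_lt σ hj] at hij

end extendNat

/-- The positions at which `extendNat σ` fails to map a consecutive pair to a consecutive pair. -/
def breakSet {m : ℕ} (σ : Equiv.Perm (Fin m)) : Finset ℕ :=
  (range (m + 1)).filter fun j => extendNat σ (j + 1) ≠ extendNat σ j + 1

lemma mem_breakSet {m : ℕ} {σ : Equiv.Perm (Fin m)} {j : ℕ} :
    j ∈ breakSet σ ↔ extendNat σ (j + 1) ≠ extendNat σ j + 1 := by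
  refine ⟨fun h => (mem_filter.mp h).2, fun h => mem_filter.mpr ⟨?_, h⟩⟩
  by_contra hj
  rw [mem_range, not_lt] at hj
  exact h (by rw [extendNat_of_lt σ (by omega), extendNat_of_lt σ (by omega)])

/-- The index of the block containing `i` when `ℕ` is cut behind the elements of `B`. -/
def blockIndex (B : Finset ℕ) (i : ℕ) : ℕ := (B.filter (· < i)).card

section blockIndex

variable {B : Finset ℕ}

@[simp] lemma blockIndex_zero : blockIndex B 0 = 0 := by simp [blockIndex]

lemma blockIndex_succ_of_mem {i : ℕ} (hi : i ∈ B) : blockIndex B (i + 1) = blockIndex B i + 1 := by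
  have h : B.filter (· < i + 1) = insert i (B.filter (· < i)) := by
    ext b
    simp only [mem_filter, mem_insert, Nat.lt_succ_iff_lt_or_eq]
    grind
  rw [blockIndex, h, card_insert_of_notMem (by simp), blockIndex]

lemma blockIndex_succ_of_notMem {i : ℕ} (hi : i ∉ B) : blockIndex B (i + 1) = blockIndex B i := by
  have h : B.filter (· < i + 1) = B.filter (· < i) := by
    ext b
    simp only [mem_filter, Nat.lt_succ_iff_lt_or_eq]
    grind
  rw [blockIndex, h, blockIndex]

lemma blockIndex_le (i : ℕ) : blockIndex B i ≤ B.card := card_filter_le _ _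

lemma blockIndex_eq_card {m i : ℕ} (hB : B ⊆ range (m + 1)) (hi : m < i) :
    blockIndex B i = B.card := by
  rw [blockIndex, filter_true_of_mem]
  intro b hb
  have := mem_range.mp (hB hb)
  omega

lemma exists_blockIndex_eq {m t : ℕ} (hB : B ⊆ range (m + 1)) (ht : t ≤ B.card) :
    ∃ i, blockIndex B i = t := by
  have key : ∀ i, ∀ t ≤ blockIndex B i, ∃ j, blockIndex B j = t := by
    intro i
    induction i with
    | zero => intro t ht; exact ⟨0, by simp at ht ⊢; omega⟩
    | succ i ih =>
      intro t ht
      by_cases h : t ≤ blockIndex B i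
      · exact ih t h
      · refine ⟨i + 1, ?_⟩
        by_cases hi : i ∈ B
        · rw [blockIndex_succ_of_mem hi] at ht ⊢; omega
        · rw [blockIndex_succ_of_notMem hi] at ht ⊢; omega
  exact key (m + 1) t (by rwa [blockIndex_eq_card hB (by omega)])

end blockIndex

/-- The map `S` sorts `ℕ` by the keys `F`, keeping the order of positions with equal keys. -/
def SortsBy (S F : ℕ → ℕ) : Prop := ∀ i j, S i < S j ↔ F i < F j ∨ F i = F j ∧ i < j

lemma sortsBy_of_imp {S F : ℕ → ℕ} (hS : Function.Injective S)
    (h : ∀ i j, S i < S j → F i < F j ∨ F i = F j ∧ i < j) : SortsBy S F := by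
  refine fun i j => ⟨h i j, fun hij => ?_⟩
  rcases lt_trichotomy (S i) (S j) with h1 | h1 | h1
  · exact h1
  · have := hS h1; subst this; omega
  · have := h j i h1; omega

lemma perm_eq_of_lt_imp_lt {n : ℕ} {χ χ' : Equiv.Perm (Fin n)}
    (h : ∀ t u, χ t < χ u → χ' t < χ' u) : χ = χ' := by
  have hmono : StrictMono (χ.symm.trans χ') := fun x y hxy => h _ _ (by simpa using hxy)
  have h1 : StrictMono.orderIsoOfSurjective _ hmono (Equiv.surjective _) = OrderIso.refl _ :=
    Subsingleton.elim _ _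
  ext t
  have h2 := congrArg (fun e : Fin n ≃o Fin n => e (χ t)) h1
  simpa using congrArg Fin.val h2.symm

lemma SortsBy.perm_eq {m : ℕ} {σ τ : Equiv.Perm (Fin m)} {F : ℕ → ℕ}
    (hσ : SortsBy (extendNat σ) F) (hτ : SortsBy (extendNat τ) F) : σ = τ := by
  refine perm_eq_of_lt_imp_lt fun t u htu => ?_
  have h := (hτ _ _).mpr ((hσ (t + 1) (u + 1)).mp (by
    rw [extendNat_succ, extendNat_succ]; simpa using htu))
  rw [extendNat_succ, extendNat_succ] at h
  simpa using h

lemma SortsBy.skeleton_eq {n m : ℕ} {S : ℕ → ℕ} {B : Finset ℕ} {χ χ' : Equiv.Perm (Fin n)}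
    (hB : B ⊆ range (m + 1)) (hcard : B.card = n + 1)
    (h : SortsBy S (extendNat χ ∘ blockIndex B)) (h' : SortsBy S (extendNat χ' ∘ blockIndex B)) :
    χ = χ' := by
  refine perm_eq_of_lt_imp_lt fun t u htu => ?_
  obtain ⟨i, hi⟩ := exists_blockIndex_eq (t := t + 1) hB (by omega)
  obtain ⟨j, hj⟩ := exists_blockIndex_eq (t := u + 1) hB (by omega)
  have h1 := (h i j).mpr (Or.inl (by
    simp only [Function.comp, hi, hj, extendNat_succ]; simpa using htu))
  have h2 := (h' i j).mp h1
  simp only [Function.comp, hi, hj, extendNat_succ] at h2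
  rcases h2 with h2 | h2
  · simpa using h2
  · have : t = u := χ'.injective (Fin.ext (by omega))
    subst this
    exact absurd htu (lt_irrefl _)

lemma SortsBy.breakSet_eq {n m : ℕ} {σ : Equiv.Perm (Fin m)} {B : Finset ℕ}
    {χ : Equiv.Perm (Fin n)} (hB : B ⊆ range (m + 1)) (hcard : B.card = n + 1)
    (hχ : ∀ t ≤ n, extendNat χ (t + 1) ≠ extendNat χ t + 1)
    (h : SortsBy (extendNat σ) (extendNat χ ∘ blockIndex B)) : breakSet σ = B := by
  ext j
  rw [mem_breakSet]
  by_cases hj : j ∈ B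
  · simp only [hj, iff_true]
    intro heq
    have hb := blockIndex_succ_of_mem hj
    have hle := blockIndex_le (B := B) (j + 1)
    have h1 := (h j (j + 1)).mp (by omega)
    simp only [Function.comp, hb] at h1
    have hne := hχ (blockIndex B j) (by omega)
    have hinj : extendNat χ (blockIndex B j) ≠ extendNat χ (blockIndex B j + 1) :=
      fun e => by have := extendNat_injective χ e; omega
    obtain ⟨t, ht⟩ := extendNat_surjective χ (extendNat χ (blockIndex B j) + 1)
    have hupper : extendNat χ (blockIndex B j + 1) ≤ n + 1 := by
      rcases Nat.lt_or_ge n (blockIndex B j + 1) with h2 | h2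
      · rw [extendNat_of_lt χ h2]; omega
      · have := extendNat_le χ h2; omega
    have htn : t ≤ n := by
      by_contra hcon
      rw [extendNat_of_lt χ (by omega)] at ht
      omega
    obtain ⟨i, hi⟩ := exists_blockIndex_eq (t := t) hB (by omega)
    have h2 := (h j i).mpr (Or.inl (by simp only [Function.comp, hi, ht]; omega))
    have h3 := (h i (j + 1)).mpr (Or.inl (by simp only [Function.comp, hi, ht, hb]; omega))
    omega
  · simp only [hj, iff_false, not_not]
    have hb := blockIndex_succ_of_notMem hj
    have h1 := (h j (j + 1)).mpr (Or.inr ⟨by simp only [Function.comp, hb], by omega⟩)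
    by_contra hne
    obtain ⟨i, hi⟩ := extendNat_surjective σ (extendNat σ j + 1)
    have h2 := (h j i).mp (by omega)
    have h3 := (h i (j + 1)).mp (by omega)
    simp only [Function.comp, hb] at h2 h3
    omega

lemma exists_sortsBy {n m : ℕ} {B : Finset ℕ} (χ : Equiv.Perm (Fin n))
    (hB : B ⊆ range (m + 1)) (hcard : B.card = n + 1) :
    ∃ σ : Equiv.Perm (Fin m), SortsBy (extendNat σ) (extendNat χ ∘ blockIndex B) := by
  set F : ℕ → ℕ := extendNat χ ∘ blockIndex B with hF
  let f : Fin m → ℕ := fun i => F (i + 1)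
  have hupper : ∀ i, F i ≤ n + 1 := by
    intro i
    have hle := blockIndex_le (B := B) i
    simp only [hF, Function.comp]
    rcases Nat.lt_or_ge n (blockIndex B i) with h | h
    · rw [extendNat_of_lt χ h]; omega
    · have := extendNat_le χ h; omega
  have hlast : ∀ i, m < i → F i = n + 1 := by
    intro i hi
    simp only [hF, Function.comp]
    rw [blockIndex_eq_card hB hi, hcard, extendNat_of_lt χ (by omega)]
  refine ⟨(Tuple.sort f)⁻¹, sortsBy_of_imp (extendNat_injective _) fun i j hij => ?_⟩
  rcases Nat.lt_or_ge m j with hj | hj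
  · rcases Nat.lt_or_ge m i with hi | hi
    · rw [extendNat_of_lt _ hi, extendNat_of_lt _ hj] at hij
      exact Or.inr ⟨by rw [hlast i hi, hlast j hj], hij⟩
    · have := hupper i
      have := hlast j hj
      omega
  · rcases eq_zero_or_fin_or_lt m i with rfl | ⟨i, rfl⟩ | hi
    · have h0 : F 0 = 0 := by simp [hF]
      have : j ≠ 0 := by rintro rfl; omega
      omega
    · rcases eq_zero_or_fin_or_lt m j with rfl | ⟨j, rfl⟩ | hj'
      · simp at hij
      · rw [extendNat_succ, extendNat_succ] at hij
        obtain ⟨hmono, hstable⟩ := (Tuple.eq_sort_iff (f := f) (σ := Tuple.sort f)).mp rfl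
        have hlt : (Tuple.sort f)⁻¹ i < (Tuple.sort f)⁻¹ j := Fin.lt_def.mpr (by omega)
        have h1 := hmono hlt.le
        have h2 := hstable _ _ hlt
        simp only [Function.comp, Equiv.Perm.inv_def, Equiv.apply_symm_apply] at h1 h2
        rcases h1.lt_or_eq with h3 | h3
        · exact Or.inl h3
        · exact Or.inr ⟨h3, by have := Fin.lt_def.mp (h2 h3); omega⟩
      · omega
    · have := extendNat_le ((Tuple.sort f)⁻¹) hj
      rw [extendNat_of_lt _ hi] at hij
      omega

section middle

variable {m : ℕ} (σ : Equiv.Perm (Fin m))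

lemma aOf_add_cOf_lt (hσ : σ ≠ 1) : aOf σ + cOf σ < m := by
  by_contra hcon
  refine hσ (Equiv.ext fun j => ?_)
  rcases Nat.lt_or_ge (j : ℕ) (aOf σ) with h | h
  · exact fix_low σ j h
  · exact fix_high σ j (by omega)

lemma extendNat_of_le_aOf {i : ℕ} (hi : i ≤ aOf σ) : extendNat σ i = i := by
  rcases eq_zero_or_fin_or_lt m i with rfl | ⟨j, rfl⟩ | h
  · rfl
  · rw [extendNat_succ, fix_low σ j (by omega)]
  · exact extendNat_of_lt σ h

lemma extendNat_of_cOf_lt {i : ℕ} (hi : m - cOf σ < i) : extendNat σ i = i := by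
  rcases eq_zero_or_fin_or_lt m i with rfl | ⟨j, rfl⟩ | h
  · rfl
  · rw [extendNat_succ, fix_high σ j (by omega)]
  · exact extendNat_of_lt σ h

lemma extendNat_aOf_succ_ne (h : aOf σ < m) : extendNat σ (aOf σ + 1) ≠ aOf σ + 1 := by
  intro heq
  have h1 : aOf σ + 1 ≤ aOf σ := by
    refine Nat.le_findGreatest (by omega) fun j hj => ?_
    rcases Nat.lt_or_ge (j : ℕ) (aOf σ) with h' | h'
    · exact fix_low σ j h'
    · have hj' : (j : ℕ) = aOf σ := by omega
      rw [← hj', extendNat_succ] at heq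
      exact Fin.ext (by omega)
  omega

lemma extendNat_sub_cOf_ne (h : cOf σ < m) : extendNat σ (m - cOf σ) ≠ m - cOf σ := by
  intro heq
  have h1 : cOf σ + 1 ≤ cOf σ := by
    refine Nat.le_findGreatest (by omega) fun j hj => ?_
    rcases Nat.lt_or_ge (j : ℕ) (m - cOf σ) with h' | h'
    · have hj' : m - cOf σ = (j : ℕ) + 1 := by omega
      rw [hj', extendNat_succ] at heq
      exact Fin.ext (by omega)
    · exact fix_high σ j h'
  omega

lemma extendNat_midPerm (s : Fin (midLen σ)) :
    extendNat σ (aOf σ + s + 1) = aOf σ + (midPerm σ s : ℕ) + 1 := by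
  have hs := s.isLt
  unfold midLen at hs
  have hlt : aOf σ + (s : ℕ) < m := by omega
  have h1 := extendNat_succ σ ⟨aOf σ + s, hlt⟩
  have h2 := mid_mem σ ⟨aOf σ + s, hlt⟩ ⟨by simp, by simp; omega⟩
  have h3 : (midPerm σ s : ℕ) = (σ ⟨aOf σ + s, hlt⟩ : ℕ) - aOf σ := rfl
  simp only at h1
  omega

lemma mem_startSet_iff (hσ : σ ≠ 1) (s : Fin (midLen σ)) :
    s ∈ startSet σ ↔ aOf σ + s ∈ breakSet σ := by
  have hac := aOf_add_cOf_lt σ hσ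
  rw [mem_breakSet, startSet, mem_filter]
  simp only [mem_univ, true_and]
  rcases Nat.eq_zero_or_pos (s : ℕ) with h0 | h0
  · simp only [h0, true_or, true_iff, add_zero]
    rw [extendNat_of_le_aOf σ le_rfl]
    exact extendNat_aOf_succ_ne σ (by omega)
  · have hlt : (s : ℕ) - 1 < midLen σ := by have := s.isLt; omega
    have h1 := extendNat_midPerm σ s
    have h2 := extendNat_midPerm σ ⟨(s : ℕ) - 1, hlt⟩
    have h3 : aOf σ + ((s : ℕ) - 1) + 1 = aOf σ + s := by omega
    simp only [h3] at h2
    rw [h1, h2]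
    constructor
    · rintro (h | h)
      · omega
      · have := h h0; omega
    · exact fun h => Or.inr fun _ => by omega

lemma breakSet_eq_insert (hσ : σ ≠ 1) :
    breakSet σ = insert (m - cOf σ) ((startSet σ).image fun s : Fin (midLen σ) => aOf σ + (s : ℕ)) := by
  have hac := aOf_add_cOf_lt σ hσ
  ext j
  simp only [mem_insert, mem_image]
  constructor
  · intro hj
    by_cases hmid : aOf σ ≤ j ∧ j < m - cOf σ
    · have hlt : j - aOf σ < midLen σ := by unfold midLen; omega
      refine Or.inr ⟨⟨j - aOf σ, hlt⟩, (mem_startSet_iff σ hσ _).mpr ?_, by simp; omega⟩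
      simpa [Nat.add_sub_cancel' hmid.1] using hj
    · left
      by_contra hne
      rw [mem_breakSet] at hj
      rcases Nat.lt_or_ge j (aOf σ) with h | h
      · exact hj (by rw [extendNat_of_le_aOf σ h, extendNat_of_le_aOf σ h.le])
      · exact hj (by rw [extendNat_of_cOf_lt σ (by omega), extendNat_of_cOf_lt σ (by omega)])
  · rintro (rfl | ⟨s, hs, rfl⟩)
    · rw [mem_breakSet, extendNat_of_cOf_lt σ (by omega)]
      have := extendNat_sub_cOf_ne σ (by omega)
      omega
    · exact (mem_startSet_iff σ hσ s).mp hs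

lemma card_filter_breakSet (hσ : σ ≠ 1) (P : ℕ → Prop) [DecidablePred P]
    (hP : ¬ P (m - cOf σ)) :
    ((breakSet σ).filter P).card = ((startSet σ).filter fun s : Fin (midLen σ) => P (aOf σ + s)).card := by
  rw [breakSet_eq_insert σ hσ, filter_insert, if_neg hP, filter_image,
    card_image_of_injective]
  intro s t hst
  simp only at hst
  exact Fin.ext (by omega)

lemma card_breakSet (hσ : σ ≠ 1) : (breakSet σ).card = (startSet σ).card + 1 := by
  rw [breakSet_eq_insert σ hσ, card_insert_of_notMem, card_image_of_injective]
  · intro s t hst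
    simp only at hst
    exact Fin.ext (by omega)
  · simp only [mem_image, not_exists, not_and]
    intro s _
    have := s.isLt
    unfold midLen at this
    omega

end middle

lemma orderIsoOfFin_symm_add_one {α : Type*} [LinearOrder α] (T : Finset α) {k : ℕ}
    (hk : T.card = k) (x : T) :
    (((T.orderIsoOfFin hk).symm x : Fin k) : ℕ) + 1 = (T.filter (· ≤ (x : α))).card := by
  obtain ⟨t, rfl⟩ := (T.orderIsoOfFin hk).surjective x
  rw [OrderIso.symm_apply_apply, ← Fin.card_Iic t]
  refine card_bij (fun u _ => (T.orderIsoOfFin hk u : α)) ?_ ?_ ?_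
  · intro u hu
    exact mem_filter.mpr ⟨(T.orderIsoOfFin hk u).2,
      (T.orderIsoOfFin hk).monotone (mem_Iic.mp hu)⟩
  · intro u _ v _ huv
    exact (T.orderIsoOfFin hk).injective (Subtype.ext huv)
  · intro y hy
    obtain ⟨hyT, hyx⟩ := mem_filter.mp hy
    refine ⟨(T.orderIsoOfFin hk).symm ⟨y, hyT⟩, mem_Iic.mpr ?_, by simp⟩
    rw [OrderIso.symm_apply_le]
    exact hyx

lemma skel_spec {m n : ℕ} {σ : Equiv.Perm (Fin m)} {χ : Equiv.Perm (Fin n)} (hσ : σ ≠ 1)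
    (h : skel σ = ⟨n, χ⟩) :
    (startSet σ).card = n ∧ ∀ s ∈ startSet σ, ∃ t : Fin n,
      (t : ℕ) + 1 = ((startSet σ).filter (· ≤ s)).card ∧
      (χ t : ℕ) + 1 = ((startSet σ).filter fun s' => midPerm σ s' ≤ midPerm σ s).card := by
  rw [skel, if_neg hσ] at h
  cases h
  refine ⟨rfl, fun s hs => ⟨((startSet σ).orderIsoOfFin rfl).symm ⟨s, hs⟩,
    orderIsoOfFin_symm_add_one _ rfl ⟨s, hs⟩, ?_⟩⟩
  simp only [Equiv.trans_apply, RelIso.coe_fn_toEquiv, OrderIso.apply_symm_apply]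
  refine (orderIsoOfFin_symm_add_one _
    (card_image_of_injective _ (midPerm σ).injective) _).trans ?_
  rw [filter_image, card_image_of_injective _ (midPerm σ).injective]
  rfl

/-- At the first position of a block, the key given by the skeleton is the rank of the image. -/
lemma extendNat_skel_blockIndex {m n : ℕ} {σ : Equiv.Perm (Fin m)} {χ : Equiv.Perm (Fin n)}
    (hσ : σ ≠ 1) (h : skel σ = ⟨n, χ⟩) {p : ℕ} (hp : p = 0 ∨ ∃ b ∈ breakSet σ, p = b + 1) :
    extendNat χ (blockIndex (breakSet σ) p) =
      ((breakSet σ).filter fun b => extendNat σ (b + 1) ≤ extendNat σ p).card := by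
  have hac := aOf_add_cOf_lt σ hσ
  obtain ⟨hcard, hspec⟩ := skel_spec hσ h
  have hend : extendNat σ (m - cOf σ + 1) = m - cOf σ + 1 := extendNat_of_cOf_lt σ (by omega)
  have hmid : ∀ s : Fin (midLen σ), aOf σ + (s : ℕ) < m - cOf σ := fun s => by
    have := s.isLt
    unfold midLen at this
    omega
  rcases hp with rfl | ⟨b, hb, rfl⟩
  · rw [blockIndex_zero, extendNat_zero, eq_comm, card_eq_zero, filter_eq_empty_iff]
    intro b _ hb
    have := extendNat_injective σ (a₁ := b + 1) (a₂ := 0) (Nat.le_zero.mp hb)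
    omega
  · have hb' := hb
    rw [breakSet_eq_insert σ hσ, mem_insert, mem_image] at hb'
    rcases hb' with rfl | ⟨s, hs, rfl⟩
    · rw [blockIndex, filter_true_of_mem, filter_true_of_mem, card_breakSet σ hσ, hcard,
        extendNat_of_lt χ (by omega)]
      all_goals
        intro b hb
        rw [breakSet_eq_insert σ hσ, mem_insert, mem_image] at hb
        rcases hb with rfl | ⟨s, hs, rfl⟩
      · exact le_rfl
      · rw [hend, extendNat_midPerm]
        have := hmid (midPerm σ s)
        omega
      · omega
      · have := hmid s
        omega
    · obtain ⟨t, ht, hχt⟩ := hspec s hs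
      have hblock : blockIndex (breakSet σ) (aOf σ + s + 1) = t + 1 := by
        rw [ht, blockIndex, card_filter_breakSet σ hσ _ (by have := hmid s; omega)]
        congr 1
        ext s'
        simp only [mem_filter, Fin.le_def]
        exact and_congr_right fun _ => by omega
      rw [hblock, extendNat_succ, hχt, card_filter_breakSet σ hσ]
      · congr 1
        ext s'
        simp only [mem_filter, Fin.le_def, extendNat_midPerm]
        exact and_congr_right fun _ => by omega
      · rw [hend, extendNat_midPerm]
        have := hmid (midPerm σ s)
        omega

lemma exists_block_start {m : ℕ} (σ : Equiv.Perm (Fin m)) (i : ℕ) :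
    ∃ p ≤ i, (p = 0 ∨ ∃ b ∈ breakSet σ, p = b + 1) ∧ (∀ b ∈ breakSet σ, p ≤ b → i ≤ b) ∧
      blockIndex (breakSet σ) i = blockIndex (breakSet σ) p ∧
      extendNat σ i = extendNat σ p + (i - p) := by
  induction i with
  | zero => exact ⟨0, le_rfl, Or.inl rfl, fun b _ h => h, rfl, by simp⟩
  | succ i ih =>
    by_cases hi : i ∈ breakSet σ
    · exact ⟨i + 1, le_rfl, Or.inr ⟨i, hi, rfl⟩, fun b _ h => h, rfl, by simp⟩
    · obtain ⟨p, hpi, hp, hno, hidx, hval⟩ := ih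
      refine ⟨p, by omega, hp, fun b hb hpb => ?_, ?_, ?_⟩
      · have h1 := hno b hb hpb
        have h2 : b ≠ i := by rintro rfl; exact hi hb
        omega
      · rw [blockIndex_succ_of_notMem hi, hidx]
      · have h1 := not_not.mp (mt mem_breakSet.mpr hi)
        omega

lemma sortsBy_skel {m n : ℕ} {σ : Equiv.Perm (Fin m)} {χ : Equiv.Perm (Fin n)}
    (hσ : σ ≠ 1) (h : skel σ = ⟨n, χ⟩) :
    SortsBy (extendNat σ) (extendNat χ ∘ blockIndex (breakSet σ)) := by
  have hinj := extendNat_injective σ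
  refine sortsBy_of_imp hinj fun i j hij => ?_
  obtain ⟨p, hpi, hp, -, hpidx, hpval⟩ := exists_block_start σ i
  obtain ⟨q, hqj, hq, hqno, hqidx, hqval⟩ := exists_block_start σ j
  simp only [Function.comp, hpidx, hqidx]
  rcases lt_trichotomy (extendNat σ p) (extendNat σ q) with hpq | hpq | hpq
  · left
    rw [extendNat_skel_blockIndex hσ h hp, extendNat_skel_blockIndex hσ h hq]
    refine card_lt_card (ssubset_iff_of_subset ?_ |>.mpr ?_)
    · exact monotone_filter_right _ fun b _ hb => hb.trans hpq.le
    · rcases hq with rfl | ⟨b, hb, rfl⟩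
      · simp at hpq
      · exact ⟨b, mem_filter.mpr ⟨hb, le_rfl⟩, fun hb' => by
          have := (mem_filter.mp hb').2
          omega⟩
  · have := hinj hpq
    subst this
    exact Or.inr ⟨rfl, by omega⟩
  · exfalso
    set d := extendNat σ p - extendNat σ q with hd
    have hrun : ∀ e, q + e ≤ j → extendNat σ (q + e) = extendNat σ q + e := by
      intro e
      induction e with
      | zero => simp
      | succ e ih =>
        intro he
        have h1 : q + e ∉ breakSet σ := fun hb => by
          have := hqno _ hb (by omega)
          omega
        have h2 := not_not.mp (mt mem_breakSet.mpr h1)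
        have h3 := ih (by omega)
        rw [← add_assoc, h2, h3]
        omega
    have hpd : p = q + d := hinj (by rw [hrun d (by omega)]; omega)
    rcases hp with rfl | ⟨b, hb, rfl⟩
    · simp at hpq
    · have := hqno b hb (by omega)
      omega

lemma extendNat_succ_ne_of_grade_eq_zero {n : ℕ} (hn : 2 ≤ n) {χ : Equiv.Perm (Fin n)}
    (hχ : grade χ = 0) (t : ℕ) (ht : t ≤ n) : extendNat χ (t + 1) ≠ extendNat χ t + 1 := by
  have hne : χ ≠ 1 := by
    intro h
    rw [grade, if_pos h] at hχ
    omega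
  rw [grade, if_neg hne] at hχ
  have ha : aOf χ = 0 := by omega
  have hc : cOf χ = 0 := by omega
  have hb : bOf χ = 0 := by omega
  have hlen : midLen χ = n := by rw [midLen, ha, hc]; omega
  rw [bOf, card_eq_zero, filter_eq_empty_iff] at hb
  intro heq
  rcases Nat.eq_zero_or_pos t with rfl | ht0
  · have := extendNat_aOf_succ_ne χ (by omega)
    rw [ha] at this
    simp at heq this
    exact this heq
  · rcases ht.lt_or_eq with htn | rfl
    · have h1 := extendNat_midPerm χ ⟨t - 1, by omega⟩
      have h2 := extendNat_midPerm χ ⟨t, by omega⟩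
      have h3 : t - 1 + 1 = t := by omega
      simp only [ha, zero_add, h3] at h1 h2
      refine hb (mem_univ (⟨t - 1, by omega⟩ : Fin (midLen χ))) ⟨by simp only; omega, ?_⟩
      simp only [h3]
      omega
    · have := extendNat_sub_cOf_ne χ (by omega)
      rw [extendNat_of_lt χ (by omega)] at heq
      rw [hc] at this
      simp at this
      omega

lemma ne_one_of_skel_eq {m n : ℕ} {σ : Equiv.Perm (Fin m)} {χ : Equiv.Perm (Fin n)}
    (hn : 2 ≤ n) (h : skel σ = ⟨n, χ⟩) : σ ≠ 1 := by
  intro h1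
  rw [skel, if_pos h1] at h
  have := congrArg Sigma.fst h
  simp only at this
  omega

/-- For a primitive `χ ∈ Σ_n` with `n ≥ 2` and every `m ≥ 1`, the number of permutations
`σ ∈ Σ_m` with `κ(σ) = χ` equals the binomial coefficient `C(m+1, n+1)`. -/
theorem card_skel_fiber (n : ℕ) (hn : 2 ≤ n) (χ : Equiv.Perm (Fin n)) (hχ : grade χ = 0)
    (m : ℕ) (hm : 1 ≤ m) :
    (@Finset.filter (Equiv.Perm (Fin m))
        (fun σ => skel σ = ⟨n, χ⟩) (Classical.decPred _) Finset.univ).card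
      = Nat.choose (m + 1) (n + 1) := by
  have hprim := extendNat_succ_ne_of_grade_eq_zero hn hχ
  rw [← card_range (m + 1), ← card_powersetCard]
  have hmem : ∀ σ : Equiv.Perm (Fin m), σ ∈ @Finset.filter (Equiv.Perm (Fin m))
      (fun σ => skel σ = ⟨n, χ⟩) (Classical.decPred _) Finset.univ ↔ skel σ = ⟨n, χ⟩ := fun σ => by
    rw [@mem_filter, and_iff_right (mem_univ σ)]
  refine card_bij (fun σ _ => breakSet σ) ?_ ?_ ?_
  · intro σ hσ
    have hskel := (hmem σ).mp hσ
    have hne := ne_one_of_skel_eq hn hskel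
    exact mem_powersetCard.mpr ⟨filter_subset _ _, by
      rw [card_breakSet σ hne, (skel_spec hne hskel).1]⟩
  · intro σ hσ τ hτ heq
    have hσ' := (hmem σ).mp hσ
    have hτ' := (hmem τ).mp hτ
    have h1 := sortsBy_skel (ne_one_of_skel_eq hn hσ') hσ'
    have h2 := sortsBy_skel (ne_one_of_skel_eq hn hτ') hτ'
    rw [← show breakSet σ = breakSet τ from heq] at h2
    exact h1.perm_eq h2
  · intro B hB
    obtain ⟨hsub, hcard⟩ := mem_powersetCard.mp hB
    obtain ⟨σ, hσ⟩ := exists_sortsBy χ hsub hcard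
    have hbreak := hσ.breakSet_eq hsub hcard hprim
    refine ⟨σ, (hmem σ).mpr ?_, hbreak⟩
    have hne : σ ≠ 1 := by
      rintro rfl
      have hempty : breakSet (1 : Equiv.Perm (Fin m)) = ∅ := by
        have hid : ∀ i, extendNat (1 : Equiv.Perm (Fin m)) i = i := by
          rintro (_ | i)
          · rfl
          · simp [extendNat]
        ext j
        simp [mem_breakSet, hid]
      rw [hempty] at hbreak
      rw [← hbreak, card_empty] at hcard
      omega
    obtain ⟨k, χ', hskel⟩ : ∃ k χ', skel σ = ⟨k, χ'⟩ := ⟨_, _, rfl⟩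
    have hk : k = n := by
      have h1 := card_breakSet σ hne
      rw [(skel_spec hne hskel).1, hbreak, hcard] at h1
      omega
    subst hk
    have h2 := sortsBy_skel hne hskel
    rw [hbreak] at h2
    rw [hskel, hσ.skeleton_eq hsub hcard h2]

end MarklOps
end

section
/- Let k be a field of characteristic zero and (B, δ) as defined. Let H be the graded unital k-algebra H = k·1 ⊕ k·w with 1 the unit in degree 0, w of degree 1, and w² = 0, equipped with the zero differential. The k-linear map φ : H → B determined by φ(1) = α + β and φ(w) = u is a homomorphism of unital graded algebras and a chain map, and it is a quasi-isomorphism: it induces isomorphisms k·1 ≅ H⁰(B, δ) and k·w ≅ H¹(B, δ). Hence the differential graded algebra (B, δ) is formal. -/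
namespace MarklOps

/-- The underlying graded vector space of the algebra `B = B⁰ ⊕ B¹`: the first factor is
`B⁰` with coordinates in the basis `{α, β}`, the second is `B¹` with coordinates in the
basis `{u, v}`. -/
abbrev BAlg (k : Type*) := (k × k) × (k × k)

/-- `α = ((1,0),(0,0))`. -/
def alphaB (k : Type*) [Field k] : BAlg k := ((1, 0), (0, 0))
/-- `β = ((0,1),(0,0))`. -/
def betaB (k : Type*) [Field k] : BAlg k := ((0, 1), (0, 0))
/-- `u = ((0,0),(1,0))`. -/
def uB (k : Type*) [Field k] : BAlg k := ((0, 0), (1, 0))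
/-- `v = ((0,0),(0,1))`. -/
def vB (k : Type*) [Field k] : BAlg k := ((0, 0), (0, 1))

/-- The multiplication of `B`, determined by `α² = α`, `β² = β`, `αβ = βα = 0`,
`αu = αv = 0`, `uβ = vβ = 0`, `uα = u`, `vα = v`, `βu = u`, `βv = v`, and all products of
two degree-one elements being zero. -/
def mulB {k : Type*} [Field k] (x y : BAlg k) : BAlg k :=
  ((x.1.1 * y.1.1, x.1.2 * y.1.2),
   (x.1.2 * y.2.1 + x.2.1 * y.1.1, x.1.2 * y.2.2 + x.2.2 * y.1.1))

/-- The degree `+1` differential `δ` of `B`, with `δα = u − v`, `δβ = v − u`,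
`δu = δv = 0`. -/
def deltaB (k : Type*) [Field k] : BAlg k →ₗ[k] BAlg k where
  toFun x := ((0, 0), (x.1.1 - x.1.2, x.1.2 - x.1.1))
  map_add' x y := by
    simp only [Prod.fst_add, Prod.snd_add, Prod.mk_add_mk, Prod.mk.injEq]
    constructor
    · simp
    · constructor <;> ring
  map_smul' c x := by
    simp only [Prod.smul_fst, Prod.smul_snd, smul_eq_mul, Prod.smul_mk, RingHom.id_apply,
      Prod.mk.injEq]
    constructor
    · simp
    · constructor <;> ring

/-- The degree-zero part `B⁰` of `B`, as a subspace of `B`. -/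
def B0 (k : Type*) [Field k] : Submodule k (BAlg k) :=
  LinearMap.ker (LinearMap.snd k (k × k) (k × k))

/-- The degree-one part `B¹` of `B`, as a subspace of `B`. -/
def B1 (k : Type*) [Field k] : Submodule k (BAlg k) :=
  LinearMap.ker (LinearMap.fst k (k × k) (k × k))

/-- The multiplication of the cohomology algebra `H = k·1 ⊕ k·w`, with `1 = (1,0)` the
unit in degree zero, `w = (0,1)` in degree one and `w² = 0`. -/
def mulH {k : Type*} [Field k] (x y : k × k) : k × k :=
  (x.1 * y.1, x.1 * y.2 + x.2 * y.1)

/-- The `k`-linear map `φ : H → B` determined by `φ(1) = α + β` and `φ(w) = u`. -/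
def phiB (k : Type*) [Field k] : (k × k) →ₗ[k] BAlg k where
  toFun x := ((x.1, x.1), (x.2, 0))
  map_add' x y := by
    simp only [Prod.fst_add, Prod.snd_add, Prod.mk_add_mk, Prod.mk.injEq]
    simp
  map_smul' c x := by
    simp only [Prod.smul_fst, Prod.smul_snd, smul_eq_mul, Prod.smul_mk, RingHom.id_apply,
      Prod.mk.injEq]
    simp

/-- The map `φ : H → B` with `φ(1) = α + β`, `φ(w) = u` is a homomorphism of unital graded
algebras and a chain map (where `H` carries the zero differential), and it is a
quasi-isomorphism: it induces isomorphisms `k·1 ≅ H⁰(B, δ)` and `k·w ≅ H¹(B, δ)`.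
Hence the differential graded algebra `(B, δ)` is formal. -/
theorem phi_quasi_isomorphism (k : Type*) [Field k] [CharZero k] :
    phiB k (1, 0) = alphaB k + betaB k ∧
    phiB k (0, 1) = uB k ∧
    (∀ x y : k × k, phiB k (mulH x y) = mulB (phiB k x) (phiB k y)) ∧
    (deltaB k).comp (phiB k) = 0 ∧
    (∀ a : k, phiB k (a, 0) ∈ B0 k) ∧
    (∀ b : k, phiB k (0, b) ∈ B1 k) ∧
    LinearMap.ker (deltaB k) ⊓ B0 k = Submodule.span k {phiB k (1, 0)} ∧
    B1 k = (B0 k).map (deltaB k) ⊔ Submodule.span k {phiB k (0, 1)} ∧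
    phiB k (0, 1) ∉ (B0 k).map (deltaB k) := by
  refine ⟨by simp [phiB, alphaB, betaB], rfl, fun x y => ?_, ?_, fun a => ?_, fun b => ?_,
    ?_, ?_, ?_⟩
  · simp [phiB, mulH, mulB]
  · ext <;> simp [phiB, deltaB]
  · simp [phiB, B0]
  · simp [phiB, B1]
  · ext ⟨⟨a, b⟩, ⟨c, d⟩⟩
    simp only [Submodule.mem_inf, LinearMap.mem_ker, Submodule.mem_span_singleton, deltaB, B0,
      phiB, LinearMap.coe_mk, AddHom.coe_mk, LinearMap.snd_apply, Prod.ext_iff, Prod.fst_zero,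
      Prod.snd_zero, Prod.smul_mk, smul_eq_mul, mul_one, mul_zero, sub_eq_zero]
    grind
  · ext ⟨⟨a, b⟩, ⟨c, d⟩⟩
    simp only [Submodule.mem_sup, Submodule.mem_map, Submodule.mem_span_singleton]
    constructor
    · intro h
      obtain ⟨rfl, rfl⟩ : a = 0 ∧ b = 0 := by simpa [B1] using h
      exact ⟨_, ⟨((0, d), (0, 0)), by simp [B0], rfl⟩, _, ⟨c + d, rfl⟩,
        by simp [deltaB, phiB]⟩
    · rintro ⟨_, ⟨x, -, rfl⟩, _, ⟨t, rfl⟩, h⟩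
      rw [← h]
      simp [B1, deltaB, phiB]
  · rintro ⟨x, -, h⟩
    simp only [deltaB, phiB, LinearMap.coe_mk, AddHom.coe_mk, Prod.mk.injEq] at h
    grind

end MarklOps
end
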